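/- Let (V, Φ) be a 3-dimensional Banach–Minkowski space and S ⊆ V*∖{0} a nonempty open set such that for all g, g' ∈ S there is a linear bijection A : ker g → ker g' with Φ(A(v)) = Φ(v) for all v ∈ ker g. Let g₀ ∈ S and H := ker g₀, and assume that Φ|_H is not a Euclidean norm. Then there exists τ ∈ V∖{0} such that DΦ_v(τ) = 0 for every v ∈ H with Φ(v) = 1; that is, τ is tangent to the unit sphere {Φ = 1} at every point of H ∩ {Φ = 1}. -/

import Mathlib

noncomputable section

def IsBanachMinkowski {V : Type*} [NormedAddCommGroup V] [NormedSpace ℝ V] (Φ : V → ℝ) : Prop :=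
  Φ 0 = 0 ∧
  (∀ v : V, v ≠ 0 → 0 < Φ v) ∧
  (∀ t : ℝ, 0 ≤ t → ∀ v : V, Φ (t • v) = t * Φ v) ∧
  (∀ v w : V, Φ (v + w) ≤ Φ v + Φ w) ∧
  ContDiffOn ℝ (⊤ : ℕ∞) Φ {(0 : V)}ᶜ ∧
  (∀ v : V, v ≠ 0 → ∀ w : V, w ≠ 0 →
    0 < iteratedFDeriv ℝ 2 (fun u => Φ u ^ 2) v ![w, w])

def IsEuclideanNorm {V : Type*} [NormedAddCommGroup V] [NormedSpace ℝ V] (Φ : V → ℝ) : Prop :=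
  ∃ Q : QuadraticForm ℝ V, Q.PosDef ∧ ∀ v : V, Φ v ^ 2 = Q v


open Filter Topology

structure Nrm (φ : ℝ × ℝ → ℝ) (D : ℝ × ℝ → (ℝ × ℝ →L[ℝ] ℝ)) : Prop where
  pos : ∀ v, v ≠ 0 → 0 < φ v
  hom : ∀ t : ℝ, 0 ≤ t → ∀ v, φ (t • v) = t * φ v
  der : ∀ v, v ≠ 0 → HasFDerivAt φ (D v) v
  cont : ContinuousOn D {0}ᶜ

namespace Nrm
variable {φ : ℝ × ℝ → ℝ} {D : ℝ × ℝ → (ℝ × ℝ →L[ℝ] ℝ)}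

lemma euler (h : Nrm φ D) (v : ℝ × ℝ) (hv : v ≠ 0) : D v v = φ v := by
  have h1 : HasDerivAt (fun t : ℝ => φ (t • v)) (D v v) 1 := by
    have hv1 : HasFDerivAt φ (D v) ((1:ℝ) • v) := by simpa using h.der v hv
    have := hv1.comp_hasDerivAt (1:ℝ) ((hasDerivAt_id (1:ℝ)).smul_const v)
    rw [one_smul] at this
    exact this
  have h2 : HasDerivAt (fun t : ℝ => φ (t • v)) (φ v) 1 := by
    have : HasDerivAt (fun t : ℝ => t * φ v) (φ v) 1 := by
      simpa using (hasDerivAt_id (1:ℝ)).mul_const (φ v)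
    refine this.congr_of_eventuallyEq ?_
    filter_upwards [lt_mem_nhds (show (0:ℝ) < 1 by norm_num)] with t ht
    exact h.hom t ht.le v
  exact h1.unique h2

lemma cont_div (h : Nrm φ D) (m : ℝ × ℝ →L[ℝ] ℝ) (hm : m ≠ 0) (X : ℝ × ℝ → ℝ × ℝ)
    (hX : Continuous X) (H : ∀ v, v ≠ 0 → m v * D v (X v) = 0) :
    ∀ v, v ≠ 0 → D v (X v) = 0 := by
  intro v hv
  by_contra hne
  apply hm
  have hc : ContinuousAt (fun w => D w (X w)) v := by
    have : ContinuousAt D v := h.cont.continuousAt (isOpen_compl_singleton.mem_nhds hv)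
    exact this.clm_apply hX.continuousAt
  have e1 : (m : ℝ × ℝ → ℝ) =ᶠ[𝓝 v] fun _ => 0 := by
    filter_upwards [hc.eventually_ne hne, isOpen_compl_singleton.mem_nhds hv] with w hw hw0
    exact (mul_eq_zero.1 (H w hw0)).resolve_right hw
  have := e1.fderiv_eq (𝕜 := ℝ)
  simpa using this

lemma parallel (h : Nrm φ D) {v q : ℝ × ℝ} (hv : v ≠ 0) (hq : D v q = 0)
    (hd : v.1 * q.2 - v.2 * q.1 = 0) : q = 0 := by
  have e := h.euler v hv
  have hp := h.pos v hv
  have k1 : D v (v.1 • q - q.1 • v) = 0 := by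
    have : v.1 • q - q.1 • v = 0 := by
      ext <;> simp <;> linarith
    rw [this]; simp
  have k2 : D v (v.2 • q - q.2 • v) = 0 := by
    have : v.2 • q - q.2 • v = 0 := by
      ext <;> simp <;> linarith
    rw [this]; simp
  simp only [map_sub, map_smul, hq, e, smul_eq_mul, mul_zero, zero_sub, neg_eq_zero,
    mul_eq_zero, hp.ne', or_false] at k1 k2
  ext <;> simp [k1, k2]

lemma detCLM (v0 : ℝ × ℝ) (hv : v0 ≠ 0) : ∃ m : ℝ × ℝ →L[ℝ] ℝ, m ≠ 0 ∧
    ∀ v, m v = v0.1 * v.2 - v0.2 * v.1 := by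
  refine ⟨v0.1 • ContinuousLinearMap.snd ℝ ℝ ℝ - v0.2 • ContinuousLinearMap.fst ℝ ℝ ℝ, ?_, ?_⟩
  · intro h0
    apply hv
    have a := congrArg (fun f => f ((1:ℝ),(0:ℝ))) h0
    have b := congrArg (fun f => f ((0:ℝ),(1:ℝ))) h0
    simp at a b
    ext <;> simp [a, b]
  · intro v; simp

lemma linear_case (h : Nrm φ D) (a b c d : ℝ) (hL : ¬ (a = 0 ∧ b = 0 ∧ c = 0 ∧ d = 0))
    (H : ∀ v : ℝ × ℝ, v ≠ 0 → D v (a * v.1 + b * v.2, c * v.1 + d * v.2) = 0) :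
    ∃ α β γ : ℝ, ∀ v : ℝ × ℝ, v ≠ 0 → φ v ^ 2 = α * v.1 ^ 2 + β * (v.1 * v.2) + γ * v.2 ^ 2 := by
  set Q : ℝ × ℝ → ℝ := fun v => v.1 * (c * v.1 + d * v.2) - v.2 * (a * v.1 + b * v.2) with hQ
  have hQne : ∀ v, v ≠ 0 → Q v ≠ 0 := by
    intro v0 hv0 hq
    have hz := h.parallel hv0 (H v0 hv0) hq
    obtain ⟨m, hm, hmv⟩ := detCLM v0 hv0
    have z1 : a * v0.1 + b * v0.2 = 0 := congrArg Prod.fst hz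
    have z2 : c * v0.1 + d * v0.2 = 0 := congrArg Prod.snd hz
    -- L v = m v • u
    have hN : 0 < v0.1 ^ 2 + v0.2 ^ 2 := by
      by_contra hh
      apply hv0
      have e1 : v0.1 = 0 := by nlinarith [sq_nonneg v0.1, sq_nonneg v0.2]
      have e2 : v0.2 = 0 := by nlinarith [sq_nonneg v0.1, sq_nonneg v0.2]
      ext <;> simp [e1, e2]
    set u : ℝ × ℝ := (v0.1 * b - v0.2 * a, v0.1 * d - v0.2 * c) with hu
    have hu0 : u ≠ 0 := by
      intro hu0
      have u1 : v0.1 * b - v0.2 * a = 0 := congrArg Prod.fst hu0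
      have u2 : v0.1 * d - v0.2 * c = 0 := congrArg Prod.snd hu0
      apply hL
      refine ⟨?_, ?_, ?_, ?_⟩ <;> refine (mul_eq_zero.1 (?_ : (v0.1 ^ 2 + v0.2 ^ 2) * _ = 0)).resolve_left hN.ne'
      · linear_combination v0.1 * z1 - v0.2 * u1
      · linear_combination v0.2 * z1 + v0.1 * u1
      · linear_combination v0.1 * z2 - v0.2 * u2
      · linear_combination v0.2 * z2 + v0.1 * u2
    have key := h.cont_div m hm (fun _ => u) continuous_const (by
      intro v hv
      have e : (v0.1 ^ 2 + v0.2 ^ 2) • ((a * v.1 + b * v.2, c * v.1 + d * v.2) : ℝ × ℝ) = m v • u := by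
        rw [hmv]
        ext
        · simp [hu]; linear_combination (v0.1 * v.1 + v0.2 * v.2) * z1
        · simp [hu]; linear_combination (v0.1 * v.1 + v0.2 * v.2) * z2
      have := congrArg (D v) e
      rw [map_smul, map_smul, H v hv] at this
      simpa using this.symm) u hu0
    have := h.euler u hu0
    have := h.pos u hu0
    simp_all
  -- derivative of Q
  set DQ : ℝ × ℝ → (ℝ × ℝ →L[ℝ] ℝ) := fun v =>
    (2 * c * v.1 + (d - a) * v.2) • ContinuousLinearMap.fst ℝ ℝ ℝ +
    (-2 * b * v.2 + (d - a) * v.1) • ContinuousLinearMap.snd ℝ ℝ ℝ with hDQ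
  have hQd : ∀ v, HasFDerivAt Q (DQ v) v := by
    intro v
    have f1 : HasFDerivAt (fun v : ℝ × ℝ => v.1) (ContinuousLinearMap.fst ℝ ℝ ℝ) v := hasFDerivAt_fst
    have f2 : HasFDerivAt (fun v : ℝ × ℝ => v.2) (ContinuousLinearMap.snd ℝ ℝ ℝ) v := hasFDerivAt_snd
    have := (f1.mul ((f1.const_mul c).add (f2.const_mul d))).sub
      (f2.mul ((f1.const_mul a).add (f2.const_mul b)))
    refine this.congr_fderiv ?_
    ext <;> simp [hDQ] <;> ring
  set ψ : ℝ × ℝ → ℝ := fun v => φ v ^ 2 / Q v with hψ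
  set Dψ : ℝ × ℝ → (ℝ × ℝ →L[ℝ] ℝ) := fun v =>
    ((2 * φ v / Q v)) • D v - (φ v ^ 2 / Q v ^ 2) • DQ v with hDψ
  have hψd : ∀ v, v ≠ 0 → HasFDerivAt ψ (Dψ v) v := by
    intro v hv
    have hd := h.der v hv
    have := ((hd.pow 2).mul ((hasDerivAt_inv (hQne v hv)).comp_hasFDerivAt v (hQd v)))
    refine (this.congr_fderiv ?_).congr_of_eventuallyEq ?_
    · ext <;> simp [hDψ] <;> ring
    · exact Eventually.of_forall fun w => by simp [hψ, div_eq_mul_inv]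
  -- components of D
  have hD1 : ∀ v, v ≠ 0 → D v (1,0) * Q v = φ v * (c * v.1 + d * v.2) := by
    intro v hv
    have e : Q v • ((1,0) : ℝ × ℝ) = (c * v.1 + d * v.2) • v
       - v.2 • ((a * v.1 + b * v.2, c * v.1 + d * v.2) : ℝ × ℝ) := by
      ext <;> simp [hQ] <;> ring
    have := congrArg (D v) e
    rw [map_smul, map_sub, map_smul, map_smul, H v hv, h.euler v hv] at this
    simp only [smul_eq_mul] at this
    linarith
  have hD2 : ∀ v, v ≠ 0 → D v (0,1) * Q v = - φ v * (a * v.1 + b * v.2) := by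
    intro v hv
    have e : Q v • ((0,1) : ℝ × ℝ) = - (a * v.1 + b * v.2) • v
       + v.1 • ((a * v.1 + b * v.2, c * v.1 + d * v.2) : ℝ × ℝ) := by
      ext <;> simp [hQ] <;> ring
    have := congrArg (D v) e
    rw [map_smul, map_add, map_smul, map_smul, H v hv, h.euler v hv] at this
    simp only [smul_eq_mul] at this
    linarith
  have hψ1 : ∀ v, v ≠ 0 → Dψ v (1,0) = (φ v / Q v) ^ 2 * ((a + d) * v.2) := by
    intro v hv
    have := hD1 v hv
    have hq := hQne v hv
    simp [hDψ, hDQ]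
    field_simp
    linear_combination 2 * φ v * this
  have hψ2 : ∀ v, v ≠ 0 → Dψ v (0,1) = (φ v / Q v) ^ 2 * (- (a + d) * v.1) := by
    intro v hv
    have := hD2 v hv
    have hq := hQne v hv
    simp [hDψ, hDQ]
    field_simp
    linear_combination 2 * φ v * this
  -- trace
  have htr : a + d = 0 := by
    have hcomp : IsCompact (Metric.sphere (0 : ℝ × ℝ) 1) := isCompact_sphere _ _
    have hne : (Metric.sphere (0 : ℝ × ℝ) 1).Nonempty := ⟨(1, 0), by simp⟩
    have hs0 : ∀ v ∈ Metric.sphere (0 : ℝ × ℝ) 1, v ≠ 0 := by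
      rintro v hv rfl; simp at hv
    obtain ⟨v, hv, hmax⟩ := hcomp.exists_isMaxOn hne
      (f := ψ) (fun v hv => (hψd v (hs0 v hv)).continuousAt.continuousWithinAt)
    have hv0 := hs0 v hv
    have hhom : ∀ w, w ≠ 0 → ψ w ≤ ψ v := by
      intro w hw
      have hw' : 0 < ‖w‖ := norm_pos_iff.2 hw
      have h1 : ‖w‖⁻¹ • w ∈ Metric.sphere (0 : ℝ × ℝ) 1 := by
        rw [mem_sphere_zero_iff_norm, norm_smul, norm_inv, norm_norm, inv_mul_cancel₀ hw'.ne']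
      have h2 := hmax h1
      have h3 : ψ (‖w‖⁻¹ • w) = ψ w := by
        have hq := hQne w hw
        have : Q (‖w‖⁻¹ • w) = (‖w‖⁻¹) ^ 2 * Q w := by simp [hQ]; ring
        simp only [hψ]
        rw [this, h.hom _ (by positivity)]
        field_simp
      simpa [h3] using h2
    have hloc : IsLocalMax ψ v := by
      filter_upwards [isOpen_compl_singleton.mem_nhds hv0] with w hw using hhom w hw
    have hz := hloc.hasFDerivAt_eq_zero (hψd v hv0)
    have e1 := hψ1 v hv0
    have e2 := hψ2 v hv0
    rw [hz] at e1 e2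
    have hr : (φ v / Q v) ^ 2 ≠ 0 := pow_ne_zero _ (div_ne_zero (h.pos v hv0).ne' (hQne v hv0))
    have e1' := (mul_eq_zero.1 e1.symm).resolve_left hr
    have e2' := (mul_eq_zero.1 e2.symm).resolve_left hr
    by_contra hne
    apply hv0
    ext
    · exact (mul_eq_zero.1 e2').resolve_left (neg_ne_zero.2 hne)
    · exact (mul_eq_zero.1 e1').resolve_left hne
  have hzero : ∀ v, v ≠ 0 → Dψ v = 0 := by
    intro v hv
    ext
    · simpa [htr] using hψ1 v hv
    · have := hψ2 v hv
      rw [htr] at this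
      simpa using this
  have hconn : IsPreconnected ({0}ᶜ : Set (ℝ × ℝ)) :=
    (isConnected_compl_singleton_of_one_lt_rank (by simp; norm_num) 0).isPreconnected
  have hconst : ∀ v, v ≠ 0 → ψ v = ψ (1,0) := by
    intro v hv
    refine IsOpen.is_const_of_fderiv_eq_zero (𝕜 := ℝ) isOpen_compl_singleton hconn ?_ ?_ hv (by simp)
    · intro w hw
      exact (hψd w hw).differentiableAt.differentiableWithinAt
    · intro w hw
      simpa using ((hψd w hw).fderiv.trans (hzero w hw))
  refine ⟨ψ (1,0) * c, ψ (1,0) * (d - a), ψ (1,0) * (- b), fun v hv => ?_⟩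
  have := hconst v hv
  have e : φ v ^ 2 = ψ v * Q v := by
    simp only [hψ]; rw [div_mul_cancel₀ _ (hQne v hv)]
  rw [e, this]
  simp only [hQ]; ring

lemma factor (a b c x y : ℝ) (hxy : x ^ 2 + y ^ 2 = 1)
    (z1 : a * x ^ 2 + b * (x * y) + c * y ^ 2 = 0) :
    ∃ p r : ℝ, ∀ v : ℝ × ℝ, a * v.1 ^ 2 + b * (v.1 * v.2) + c * v.2 ^ 2
      = (x * v.2 - y * v.1) * (p * v.1 + r * v.2) := by
  set β := -2 * a * x * y + b * (x ^ 2 - y ^ 2) + 2 * c * x * y with hβ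
  set κ := a * y ^ 2 - b * x * y + c * x ^ 2 with hκ
  refine ⟨β * x - κ * y, β * y + κ * x, fun v => ?_⟩
  rw [hβ, hκ]
  linear_combination (x * v.1 + y * v.2) ^ 2 * z1 - (1 + x ^ 2 + y ^ 2) * (a * v.1 ^ 2 + b * (v.1 * v.2) + c * v.2 ^ 2) * hxy

lemma quad_case (h : Nrm φ D) (a b c a' b' c' : ℝ)
    (hE : ¬ ∃ α β γ : ℝ, ∀ v : ℝ × ℝ, v ≠ 0 →
      φ v ^ 2 = α * v.1 ^ 2 + β * (v.1 * v.2) + γ * v.2 ^ 2)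
    (H : ∀ v : ℝ × ℝ, v ≠ 0 → D v (a * v.1 ^ 2 + b * (v.1 * v.2) + c * v.2 ^ 2,
      a' * v.1 ^ 2 + b' * (v.1 * v.2) + c' * v.2 ^ 2) = 0) :
    ∀ v : ℝ × ℝ, a * v.1 ^ 2 + b * (v.1 * v.2) + c * v.2 ^ 2 = 0 ∧ 
      a' * v.1 ^ 2 + b' * (v.1 * v.2) + c' * v.2 ^ 2 = 0 := by
  obtain ⟨x, y, hxy, hc⟩ : ∃ x y : ℝ, x ^ 2 + y ^ 2 = 1 ∧
      x * (a' * x ^ 2 + b' * (x * y) + c' * y ^ 2) - y * (a * x ^ 2 + b * (x * y) + c * y ^ 2) = 0 := by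
    set F : ℝ → ℝ := fun t => Real.cos t * (a' * Real.cos t ^ 2 + b' * (Real.cos t * Real.sin t)
      + c' * Real.sin t ^ 2) - Real.sin t * (a * Real.cos t ^ 2 + b * (Real.cos t * Real.sin t)
      + c * Real.sin t ^ 2) with hF
    have hFc : Continuous F := by fun_prop
    have h0 : F 0 = a' := by simp [hF]
    have h1 : F Real.pi = -a' := by simp [hF]
    have : (0:ℝ) ∈ Set.uIcc (F 0) (F Real.pi) := by
      rw [h0, h1, Set.mem_uIcc]
      rcases le_total a' 0 with h | h
      · left; constructor <;> linarith
      · right; constructor <;> linarith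
    obtain ⟨t, -, ht⟩ := intermediate_value_uIcc (hFc.continuousOn) this
    exact ⟨Real.cos t, Real.sin t, Real.cos_sq_add_sin_sq t, ht⟩
  have hv0 : ((x, y) : ℝ × ℝ) ≠ 0 := by
    intro hh
    have e1 : x = 0 := congrArg Prod.fst hh
    have e2 : y = 0 := congrArg Prod.snd hh
    simp [e1, e2] at hxy
  have hz := h.parallel hv0 (H _ hv0) hc
  have z1 : a * x ^ 2 + b * (x * y) + c * y ^ 2 = 0 := congrArg Prod.fst hz
  have z2 : a' * x ^ 2 + b' * (x * y) + c' * y ^ 2 = 0 := congrArg Prod.snd hz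
  obtain ⟨m, hm, hmv⟩ := detCLM _ hv0
  simp only at hmv
  -- q = m * L,  L = p v.1 + r v.2
  obtain ⟨p, r, hpr⟩ := factor a b c x y hxy z1
  obtain ⟨p', r', hpr'⟩ := factor a' b' c' x y hxy z2
  simp only [← hmv] at hpr hpr'
  have key := h.cont_div m hm (fun v => (p * v.1 + r * v.2, p' * v.1 + r' * v.2)) (by fun_prop) (by
    intro v hv
    have := H v hv
    rw [hpr, hpr'] at this
    have e : ((m v * (p * v.1 + r * v.2), m v * (p' * v.1 + r' * v.2)) : ℝ × ℝ) =
      m v • (p * v.1 + r * v.2, p' * v.1 + r' * v.2) := by simp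
    rw [e, map_smul] at this
    exact this)
  by_cases hL : p = 0 ∧ r = 0 ∧ p' = 0 ∧ r' = 0
  · obtain ⟨rfl, rfl, rfl, rfl⟩ := hL
    intro v; rw [hpr, hpr']; simp
  · exact absurd (h.linear_case p r p' r' hL key) hE

end Nrm

section core
variable {V : Type*} [NormedAddCommGroup V] [NormedSpace ℝ V] [FiniteDimensional ℝ V]

lemma nrm_of {Φ : V → ℝ} (hΦ : IsBanachMinkowski Φ) (j : ℝ × ℝ →L[ℝ] V)
    (hj : Function.Injective j) :
    Nrm (fun v => Φ (j v)) (fun v => (fderiv ℝ Φ (j v)).comp j) := by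
  obtain ⟨h0, hpos, hhom, htri, hsm, hconv⟩ := hΦ
  have hj0 : ∀ v, v ≠ 0 → j v ≠ 0 := fun v hv hh => hv (hj (by simpa using hh))
  refine ⟨fun v hv => hpos _ (hj0 v hv), fun t ht v => ?_, fun v hv => ?_, ?_⟩
  · simp only [map_smul]; exact hhom t ht _
  · have hd : DifferentiableAt ℝ Φ (j v) :=
      (hsm.contDiffAt (isOpen_compl_singleton.mem_nhds (hj0 v hv))).differentiableAt (by simp)
    exact hd.hasFDerivAt.comp v j.hasFDerivAt
  · have hc : ContinuousOn (fderiv ℝ Φ) {0}ᶜ :=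
      hsm.continuousOn_fderiv_of_isOpen isOpen_compl_singleton (by simp)
    have : ContinuousOn (fun v => fderiv ℝ Φ (j v)) {0}ᶜ :=
      hc.comp j.continuous.continuousOn (fun v hv => hj0 v hv)
    exact this.clm_comp continuousOn_const

lemma cont_of {Φ : V → ℝ} (hΦ : IsBanachMinkowski Φ) : Continuous Φ := by
  obtain ⟨h0, hpos, hhom, htri, hsm, hconv⟩ := hΦ
  have : ConvexOn ℝ Set.univ Φ := by
    refine ⟨convex_univ, fun x _ y _ a b ha hb _ => ?_⟩
    have := htri (a • x) (b • y)
    rw [hhom a ha, hhom b hb] at this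
    simpa using this
  rw [← continuousOn_univ]
  exact this.continuousOn isOpen_univ

lemma lower_bound {Φ : V → ℝ} (hΦ : IsBanachMinkowski Φ) :
    ∃ c : ℝ, 0 < c ∧ ∀ v, c * ‖v‖ ≤ Φ v := by
  have hc := cont_of hΦ
  obtain ⟨h0, hpos, hhom, htri, hsm, hconv⟩ := hΦ
  rcases subsingleton_or_nontrivial V with hs | hn
  · exact ⟨1, one_pos, fun v => by rw [Subsingleton.elim v 0]; simp [h0]⟩
  obtain ⟨v, hv, hmin⟩ := (isCompact_sphere (0 : V) 1).exists_isMinOn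
    (NormedSpace.sphere_nonempty.2 zero_le_one) hc.continuousOn
  have hv0 : v ≠ 0 := by rintro rfl; simp at hv
  refine ⟨Φ v, hpos v hv0, fun w => ?_⟩
  rcases eq_or_ne w 0 with rfl | hw
  · simp [h0]
  have hw' : 0 < ‖w‖ := norm_pos_iff.2 hw
  have h1 : ‖w‖⁻¹ • w ∈ Metric.sphere (0 : V) 1 := by
    rw [mem_sphere_zero_iff_norm, norm_smul, norm_inv, norm_norm, inv_mul_cancel₀ hw'.ne']
  have h2 : Φ v ≤ Φ (‖w‖⁻¹ • w) := hmin h1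
  rw [hhom _ (by positivity)] at h2
  calc Φ v * ‖w‖ ≤ (‖w‖⁻¹ * Φ w) * ‖w‖ := by gcongr
    _ = Φ w := by field_simp

lemma ultra_lim {W : Type*} [NormedAddCommGroup W] [NormedSpace ℝ W] [FiniteDimensional ℝ W]
    (U : Ultrafilter ℕ) (f : ℕ → W) (K : ℝ) (hf : ∀ n, ‖f n‖ ≤ K) :
    ∃ w, Tendsto f U (𝓝 w) := by
  have : ProperSpace W := FiniteDimensional.proper ℝ W
  have hK := isCompact_closedBall (0 : W) K
  have hle : ((U.map f : Ultrafilter W) : Filter W) ≤ 𝓟 (Metric.closedBall (0 : W) K) := by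
    rw [Ultrafilter.coe_map, le_principal_iff]
    exact Eventually.of_forall (p := fun n => f n ∈ Metric.closedBall (0 : W) K)
      fun n => by simpa using hf n
  obtain ⟨w, -, hw⟩ := hK.ultrafilter_le_nhds _ hle
  exact ⟨w, hw⟩

lemma core {Φ : V → ℝ} (hΦ : IsBanachMinkowski Φ) (g₀ : V →L[ℝ] ℝ)
    (j : ℝ × ℝ →L[ℝ] V) (k : V →L[ℝ] ℝ × ℝ) (hkj : ∀ v, k (j v) = v)
    (hjk : ∀ w, g₀ w = 0 → j (k w) = w) (hgj : ∀ v, g₀ (j v) = 0)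
    (hE : ¬ ∃ α β γ : ℝ, ∀ v : ℝ × ℝ, v ≠ 0 →
      Φ (j v) ^ 2 = α * v.1 ^ 2 + β * (v.1 * v.2) + γ * v.2 ^ 2)
    (h : V →L[ℝ] ℝ) (t : ℕ → ℝ) (ht : ∀ n, 0 < t n) (ht0 : Tendsto t atTop (𝓝 0))
    (P : ℕ → (ℝ × ℝ →L[ℝ] V)) (hP : ∀ n v, Φ (P n v) = Φ (j v))
    (hgP : ∀ n v, g₀ (P n v) = t n * h (P n v)) :
    ∃ B : ℝ × ℝ →L[ℝ] V, (∀ v, v ≠ 0 → fderiv ℝ Φ (j v) (B v) = 0) ∧ ∀ v, g₀ (B v) = h (j v) := by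
  have hc := cont_of hΦ
  obtain ⟨c, hc0, hcb⟩ := lower_bound hΦ
  have hj : Function.Injective j := Function.LeftInverse.injective hkj
  have N := nrm_of hΦ j hj
  have hj0 : ∀ v, v ≠ 0 → j v ≠ 0 := fun v hv hh => hv (hj (by simpa using hh))
  obtain ⟨h0, hpos, hhom, htri, hsm, hconv⟩ := hΦ
  -- upper bound
  obtain ⟨M, hM0, hM⟩ : ∃ M : ℝ, 0 ≤ M ∧ ∀ v : ℝ × ℝ, Φ (j v) ≤ M * ‖v‖ := by
    obtain ⟨v, hv, hmax⟩ := (isCompact_closedBall (0 : ℝ × ℝ) 1).exists_isMaxOn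
      ⟨0, by simp⟩ (hc.comp j.continuous).continuousOn
    have hnn : ∀ w, 0 ≤ Φ w := fun w => le_trans (by positivity) (hcb w)
    refine ⟨Φ (j v), hnn _, fun w => ?_⟩
    rcases eq_or_ne w 0 with rfl | hw
    · simp [h0]
    have hw' : 0 < ‖w‖ := norm_pos_iff.2 hw
    have h1 : ‖w‖⁻¹ • w ∈ Metric.closedBall (0 : ℝ × ℝ) 1 := by
      rw [mem_closedBall_zero_iff, norm_smul, norm_inv, norm_norm, inv_mul_cancel₀ hw'.ne']
    have h2 : Φ (j (‖w‖⁻¹ • w)) ≤ Φ (j v) := hmax h1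
    rw [map_smul, hhom _ (by positivity)] at h2
    calc Φ (j w) = (‖w‖⁻¹ * Φ (j w)) * ‖w‖ := by field_simp
      _ ≤ _ := by gcongr
  set U : Ultrafilter ℕ := hyperfilter ℕ with hU
  have hUle : (U : Filter ℕ) ≤ atTop := by
    rw [← Nat.cofinite_eq_atTop]; exact hyperfilter_le_cofinite
  have htU : Tendsto t U (𝓝 0) := ht0.mono_left hUle
  obtain ⟨Pi, hPi⟩ := ultra_lim U P (M / c) (fun n =>
    ContinuousLinearMap.opNorm_le_bound _ (by positivity) (fun v => by
      have h1 := hcb (P n v)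
      rw [hP] at h1
      have h2 := hM v
      rw [div_mul_eq_mul_div, le_div_iff₀ hc0]
      linarith))
  have hPv : ∀ v, Tendsto (fun n => P n v) U (𝓝 (Pi v)) := fun v =>
    ((ContinuousLinearMap.apply ℝ V v).continuous.tendsto Pi).comp hPi
  have hPiΦ : ∀ v, Φ (Pi v) = Φ (j v) := fun v =>
    tendsto_nhds_unique ((hc.tendsto _).comp (hPv v))
      (by simp only [Function.comp_def, hP]; exact tendsto_const_nhds)
  have hPig : ∀ v, g₀ (Pi v) = 0 := fun v => by
    refine tendsto_nhds_unique ((g₀.continuous.tendsto _).comp (hPv v)) ?_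
    simp only [Function.comp_def, hgP]
    simpa using htU.mul ((h.continuous.tendsto _).comp (hPv v))
  -- the limit isometry
  set R : ℝ × ℝ →ₗ[ℝ] ℝ × ℝ := (k.comp Pi).toLinearMap with hR
  have hjR : ∀ v, j (R v) = Pi v := fun v => hjk _ (hPig v)
  have hRinj : Function.Injective R := by
    rw [← LinearMap.ker_eq_bot, LinearMap.ker_eq_bot']
    intro v hv
    by_contra hne
    have := hpos _ (hj0 v hne)
    rw [← hPiΦ, ← hjR, hv] at this
    simp [h0] at this
  set Re := (LinearEquiv.ofInjectiveEndo R hRinj).toContinuousLinearEquiv with hRe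
  have hRe' : ∀ v, R (Re.symm v) = v := fun v => Re.apply_symm_apply v
  set P' : ℕ → (ℝ × ℝ →L[ℝ] V) := fun n => (P n).comp (Re.symm : ℝ × ℝ →L[ℝ] ℝ × ℝ) with hP'
  have hP'Φ : ∀ n v, Φ (P' n v) = Φ (j v) := fun n v => by
    have : Φ (P' n v) = Φ (j (Re.symm v)) := hP n _
    rw [this, ← hPiΦ, ← hjR, hRe']
  have hP'g : ∀ n v, g₀ (P' n v) = t n * h (P' n v) := fun n v => hgP n _
  have hP'l : Tendsto P' U (𝓝 j) := by
    have h1 : Tendsto P' U (𝓝 (Pi.comp (Re.symm : ℝ × ℝ →L[ℝ] ℝ × ℝ))) :=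
      (((ContinuousLinearMap.compL ℝ (ℝ × ℝ) (ℝ × ℝ) V).flip (Re.symm : ℝ × ℝ →L[ℝ] ℝ × ℝ)).continuous.tendsto Pi).comp hPi
    convert h1 using 2
    refine ContinuousLinearMap.ext fun v => ?_
    change j v = Pi (Re.symm v)
    rw [← hjR, hRe']
  have hP'v : ∀ v, Tendsto (fun n => P' n v) U (𝓝 (j v)) := fun v =>
    ((ContinuousLinearMap.apply ℝ V v).continuous.tendsto j).comp hP'l
  -- difference
  set C : ℕ → (ℝ × ℝ →L[ℝ] V) := fun n => P' n - j with hC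
  have hC0 : Tendsto C U (𝓝 0) := by simpa [hC] using hP'l.sub_const j
  set s : ℕ → ℝ := fun n => ‖C n‖ + t n with hs
  have hspos : ∀ n, 0 < s n := fun n => add_pos_of_nonneg_of_pos (norm_nonneg _) (ht n)
  have hs0 : Tendsto s U (𝓝 0) := by simpa using hC0.norm.add htU
  obtain ⟨B, hB⟩ := ultra_lim U (fun n => (s n)⁻¹ • C n) 1 (fun n => by
    rw [norm_smul, norm_inv, Real.norm_of_nonneg (hspos n).le, inv_mul_le_one₀ (hspos n)]
    simp only [hs]; linarith [ht n])
  obtain ⟨θ, hθ⟩ := ultra_lim U (fun n => (s n)⁻¹ * t n) 1 (fun n => by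
    rw [norm_mul, norm_inv, Real.norm_of_nonneg (hspos n).le, Real.norm_of_nonneg (ht n).le,
      inv_mul_le_one₀ (hspos n)]
    simp only [hs]; linarith [norm_nonneg (C n)])
  have hBv : ∀ v, Tendsto (fun n => (s n)⁻¹ • (C n v)) U (𝓝 (B v)) := fun v =>
    ((ContinuousLinearMap.apply ℝ V v).continuous.tendsto B).comp hB
  have hsum : ‖B‖ + θ = 1 := by
    refine tendsto_nhds_unique (hB.norm.add hθ) ?_
    refine tendsto_const_nhds.congr fun n => ?_
    rw [norm_smul, norm_inv, Real.norm_of_nonneg (hspos n).le, ← mul_add]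
    exact (inv_mul_cancel₀ (hspos n).ne').symm
  have hBg : ∀ v, g₀ (B v) = θ * h (j v) := fun v => by
    refine tendsto_nhds_unique ((g₀.continuous.tendsto _).comp (hBv v)) ?_
    refine (hθ.mul ((h.continuous.tendsto _).comp (hP'v v))).congr fun n => ?_
    simp only [Function.comp_apply, map_smul, smul_eq_mul, hC, ContinuousLinearMap.sub_apply,
      map_sub, hgj, hP'g, sub_zero]
    ring
  have hBD : ∀ v, v ≠ 0 → fderiv ℝ Φ (j v) (B v) = 0 := fun v hv => by
    have hd : DifferentiableAt ℝ Φ (j v) :=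
      (hsm.contDiffAt (isOpen_compl_singleton.mem_nhds (hj0 v hv))).differentiableAt (by simp)
    have hdl : Tendsto (fun n => C n v) U (𝓝 0) := by
      simpa [hC] using (hP'v v).sub_const (j v)
    have := (hasFDerivWithinAt_univ.2 hd.hasFDerivAt).lim hdl
      (Eventually.of_forall fun _ => Set.mem_univ _) (hBv v)
    refine tendsto_nhds_unique this ?_
    refine tendsto_const_nhds.congr fun n => ?_
    have e : j v + C n v = P' n v := by simp [hC]
    rw [e, hP'Φ]; simp
  rcases eq_or_ne θ 0 with hθ0 | hθ0
  · exfalso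
    have hB0 : B ≠ 0 := by
      rintro rfl
      simp [hθ0] at hsum
    have hjB : ∀ v, j (k (B v)) = B v := fun v => hjk _ (by rw [hBg, hθ0, zero_mul])
    set L := k.comp B with hL
    have hLv : ∀ v, L v = ((L (1,0)).1 * v.1 + (L (0,1)).1 * v.2,
        (L (1,0)).2 * v.1 + (L (0,1)).2 * v.2) := by
      intro v
      have : v = v.1 • ((1,0) : ℝ × ℝ) + v.2 • ((0,1) : ℝ × ℝ) := by ext <;> simp
      conv_lhs => rw [this, map_add, map_smul, map_smul]
      ext <;> simp <;> ring
    refine hE (N.linear_case (L (1,0)).1 (L (0,1)).1 (L (1,0)).2 (L (0,1)).2 ?_ ?_)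
    · rintro ⟨a1, a2, a3, a4⟩
      apply hB0
      refine ContinuousLinearMap.ext fun v => ?_
      have e : L v = 0 := by rw [hLv, a1, a2, a3, a4]; simp
      rw [← hjB]
      change j (L v) = 0
      rw [e, map_zero]
    · intro v hv
      rw [← hLv]
      change fderiv ℝ Φ (j v) (j (k (B v))) = 0
      rw [hjB, hBD v hv]
  · refine ⟨θ⁻¹ • B, fun v hv => ?_, fun v => ?_⟩
    · simp [hBD v hv]
    · simp [hBg, hθ0]

lemma final {Φ : V → ℝ} (hΦ : IsBanachMinkowski Φ) (g₀ : V →L[ℝ] ℝ)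
    (j : ℝ × ℝ →L[ℝ] V) (k : V →L[ℝ] ℝ × ℝ) (hkj : ∀ v, k (j v) = v)
    (hjk : ∀ w, g₀ w = 0 → j (k w) = w)
    (hE : ¬ ∃ α β γ : ℝ, ∀ v : ℝ × ℝ, v ≠ 0 →
      Φ (j v) ^ 2 = α * v.1 ^ 2 + β * (v.1 * v.2) + γ * v.2 ^ 2)
    (B1 B2 : ℝ × ℝ →L[ℝ] V)
    (h1 : ∀ v, v ≠ 0 → fderiv ℝ Φ (j v) (B1 v) = 0) (h1' : ∀ v, g₀ (B1 v) = v.1)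
    (h2 : ∀ v, v ≠ 0 → fderiv ℝ Φ (j v) (B2 v) = 0) (h2' : ∀ v, g₀ (B2 v) = v.2) :
    ∃ τ : V, τ ≠ 0 ∧ ∀ v, v ≠ 0 → fderiv ℝ Φ (j v) τ = 0 := by
  have hj : Function.Injective j := Function.LeftInverse.injective hkj
  have N := nrm_of hΦ j hj
  have hq : ∀ v : ℝ × ℝ, j (k (v.2 • B1 v - v.1 • B2 v)) = v.2 • B1 v - v.1 • B2 v := fun v =>
    hjk _ (by simp [h1', h2']; ring)
  have dec : ∀ (B : ℝ × ℝ →L[ℝ] V) (v : ℝ × ℝ), B v = v.1 • B (1,0) + v.2 • B (0,1) := by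
    intro B v
    rw [← map_smul, ← map_smul, ← map_add]
    congr 1
    ext <;> simp
  have e : ∀ v : ℝ × ℝ, k (v.2 • B1 v - v.1 • B2 v) =
     (-(k (B2 (1,0))).1 * v.1 ^ 2 + ((k (B1 (1,0))).1 - (k (B2 (0,1))).1) * (v.1 * v.2)
        + (k (B1 (0,1))).1 * v.2 ^ 2,
      -(k (B2 (1,0))).2 * v.1 ^ 2 + ((k (B1 (1,0))).2 - (k (B2 (0,1))).2) * (v.1 * v.2)
        + (k (B1 (0,1))).2 * v.2 ^ 2) := by
    intro v
    rw [dec B1 v, dec B2 v]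
    ext <;> simp <;> ring
  have key := N.quad_case _ _ _ _ _ _ hE (fun v hv => by
    rw [← e v]
    change fderiv ℝ Φ (j v) (j (k _)) = 0
    rw [hq]
    simp [h1 v hv, h2 v hv])
  have key2 : ∀ v : ℝ × ℝ, v.2 • B1 v - v.1 • B2 v = 0 := fun v => by
    rw [← hq, e, (key v).1, (key v).2]
    exact map_zero j
  have a1 : B2 (1,0) = 0 := by simpa using key2 (1,0)
  have a2 : B1 (0,1) = 0 := by simpa using key2 (0,1)
  have a3 : B1 (1,0) = B2 (0,1) := by
    have := key2 (1,1)
    rw [dec B1, dec B2, a1, a2] at this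
    simpa [sub_eq_zero] using this
  refine ⟨B1 (1,0), ?_, fun v hv => ?_⟩
  · intro hz
    have := h1' (1,0)
    rw [hz] at this
    simp at this
  · by_cases hv1 : v.1 = 0
    · have hv2 : v.2 ≠ 0 := fun hh => hv (by ext <;> simp [hv1, hh])
      have := h2 v hv
      rw [dec B2 v, a1, ← a3] at this
      simpa [hv2] using this
    · have := h1 v hv
      rw [dec B1 v, a2] at this
      simpa [hv1] using this

end core

/-- Lemma: existence of the tangent vector `τ`: if `S` is a nonempty
open family of nonzero functionals whose kernel planes carry pairwise isometric
restrictions of `Φ`, and `Φ` restricted to `H = ker g₀` (`g₀ ∈ S`) is not Euclidean, then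
there is `τ ≠ 0` tangent to the unit sphere `{Φ = 1}` at every point of `H ∩ {Φ = 1}`. -/
theorem statement11 (V : Type*) [NormedAddCommGroup V] [NormedSpace ℝ V]
    [FiniteDimensional ℝ V] (hdim : Module.finrank ℝ V = 3)
    (Φ : V → ℝ) (hΦ : IsBanachMinkowski Φ)
    (S : Set (V →L[ℝ] ℝ)) (hSne : S.Nonempty) (hSopen : IsOpen S)
    (hS0 : ∀ g ∈ S, g ≠ 0)
    (hiso : ∀ g ∈ S, ∀ g' ∈ S,
      ∃ A : LinearMap.ker (g : V →ₗ[ℝ] ℝ) ≃ₗ[ℝ] LinearMap.ker (g' : V →ₗ[ℝ] ℝ),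
        ∀ v : LinearMap.ker (g : V →ₗ[ℝ] ℝ),
          Φ ((A v : LinearMap.ker (g' : V →ₗ[ℝ] ℝ)) : V) = Φ (v : V))
    (g₀ : V →L[ℝ] ℝ) (hg₀ : g₀ ∈ S)
    (hnotEucl : ¬ IsEuclideanNorm (fun v : LinearMap.ker (g₀ : V →ₗ[ℝ] ℝ) => Φ (v : V))) :
    ∃ τ : V, τ ≠ 0 ∧ ∀ v : V, v ∈ LinearMap.ker (g₀ : V →ₗ[ℝ] ℝ) → Φ v = 1 →
      fderiv ℝ Φ v τ = 0 := by
  set H := LinearMap.ker (g₀ : V →ₗ[ℝ] ℝ) with hH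
  have hg0 := hS0 g₀ hg₀
  have hfr : Module.finrank ℝ H = 2 := by
    have h1 := LinearMap.finrank_range_add_finrank_ker (g₀ : V →ₗ[ℝ] ℝ)
    have h2 : LinearMap.range (g₀ : V →ₗ[ℝ] ℝ) = ⊤ := by
      rw [LinearMap.range_eq_top]
      refine LinearMap.surjective fun hh => hg0 ?_
      ext v
      exact congrArg (fun f : V →ₗ[ℝ] ℝ => f v) hh
    rw [h2, finrank_top, hdim, Module.finrank_self] at h1
    change 1 + Module.finrank ℝ H = 3 at h1
    omega
  let e : (ℝ × ℝ) ≃L[ℝ] H := ContinuousLinearEquiv.ofFinrankEq (by rw [hfr]; simp)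
  let j : ℝ × ℝ →L[ℝ] V := H.subtypeL.comp (e : ℝ × ℝ →L[ℝ] H)
  have hjv : ∀ v, j v = (e v : V) := fun v => rfl
  have hjinj : Function.Injective j := Subtype.val_injective.comp e.injective
  obtain ⟨k', hk'⟩ := LinearMap.exists_leftInverse_of_injective (j : ℝ × ℝ →ₗ[ℝ] V)
    (LinearMap.ker_eq_bot.2 hjinj)
  let k : V →L[ℝ] ℝ × ℝ := LinearMap.toContinuousLinearMap k'
  have hkj : ∀ v, k (j v) = v := fun v => congrArg (fun f => f v) hk'
  have hsurj : ∀ w, g₀ w = 0 → ∃ v, j v = w := fun w hw =>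
    ⟨e.symm ⟨w, hw⟩, by rw [hjv, e.apply_symm_apply]⟩
  have hjk : ∀ w, g₀ w = 0 → j (k w) = w := fun w hw => by
    obtain ⟨v, rfl⟩ := hsurj w hw
    rw [hkj]
  have hgj : ∀ v, g₀ (j v) = 0 := fun v => (e v).2
  have hE : ¬ ∃ α β γ : ℝ, ∀ v : ℝ × ℝ, v ≠ 0 →
      Φ (j v) ^ 2 = α * v.1 ^ 2 + β * (v.1 * v.2) + γ * v.2 ^ 2 := by
    rintro ⟨α, β, γ, hq⟩
    apply hnotEucl
    let X : H →ₗ[ℝ] ℝ := LinearMap.fst ℝ ℝ ℝ ∘ₗ (e.symm : H →ₗ[ℝ] ℝ × ℝ)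
    let Y : H →ₗ[ℝ] ℝ := LinearMap.snd ℝ ℝ ℝ ∘ₗ (e.symm : H →ₗ[ℝ] ℝ × ℝ)
    let Q : QuadraticForm ℝ H := α • QuadraticMap.linMulLin X X + β • QuadraticMap.linMulLin X Y
      + γ • QuadraticMap.linMulLin Y Y
    have hQ : ∀ w : H, Φ (w : V) ^ 2 = Q w := by
      intro w
      rcases eq_or_ne w 0 with rfl | hw
      · simp [hΦ.1]
      · have := hq (e.symm w) (by simpa using hw)
        rw [hjv, e.apply_symm_apply] at this
        rw [this]
        simp [Q, X, Y]
        ring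
    refine ⟨Q, fun w hw => ?_, hQ⟩
    rw [← hQ]
    have := hΦ.2.1 (w : V) (by simpa using hw)
    positivity
  have main : ∀ h : V →L[ℝ] ℝ, ∃ B : ℝ × ℝ →L[ℝ] V,
      (∀ v, v ≠ 0 → fderiv ℝ Φ (j v) (B v) = 0) ∧ ∀ v, g₀ (B v) = h (j v) := by
    intro h
    have hcont : Tendsto (fun t : ℝ => g₀ - t • h) (𝓝 0) (𝓝 g₀) := by
      have : Continuous (fun t : ℝ => g₀ - t • h) := by fun_prop
      simpa using this.tendsto 0
    have hev : ∀ᶠ n : ℕ in atTop, g₀ - (1 / ((n : ℝ) + 1)) • h ∈ S :=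
      (hcont.comp tendsto_one_div_add_atTop_nhds_zero_nat).eventually (hSopen.mem_nhds hg₀)
    obtain ⟨m, hm⟩ := eventually_atTop.1 hev
    have hex : ∀ n : ℕ, ∃ P : ℝ × ℝ →L[ℝ] V, (∀ v, Φ (P v) = Φ (j v)) ∧
        ∀ v, g₀ (P v) = (1 / (((n + m : ℕ) : ℝ) + 1)) * h (P v) := by
      intro n
      obtain ⟨A, hA⟩ := hiso g₀ hg₀ _ (hm (n + m) (Nat.le_add_left _ _))
      refine ⟨LinearMap.toContinuousLinearMap
        ((Submodule.subtype _ ∘ₗ A.toLinearMap) ∘ₗ e.toLinearEquiv.toLinearMap), fun v => hA (e v), fun v => ?_⟩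
      have := (A (e v)).2
      rw [LinearMap.mem_ker] at this
      change g₀ (A (e v) : V) - (1 / (((n + m : ℕ) : ℝ) + 1)) * h (A (e v) : V) = 0 at this
      exact sub_eq_zero.1 this
    choose P hP1 hP2 using hex
    exact core hΦ g₀ j k hkj hjk hgj hE h (fun n => 1 / (((n + m : ℕ) : ℝ) + 1))
      (fun n => by positivity)
      ((tendsto_add_atTop_iff_nat m).2 tendsto_one_div_add_atTop_nhds_zero_nat) P hP1 hP2
  obtain ⟨B1, h1, h1'⟩ := main ((ContinuousLinearMap.fst ℝ ℝ ℝ).comp k)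
  obtain ⟨B2, h2, h2'⟩ := main ((ContinuousLinearMap.snd ℝ ℝ ℝ).comp k)
  obtain ⟨τ, hτ, hτ'⟩ := final hΦ g₀ j k hkj hjk hE B1 B2 h1
    (fun v => by rw [h1' v]; simp [hkj]) h2 (fun v => by rw [h2' v]; simp [hkj])
  refine ⟨τ, hτ, fun v hv hv1 => ?_⟩
  obtain ⟨u, rfl⟩ := hsurj v hv
  refine hτ' u ?_
  rintro rfl
  rw [map_zero, hΦ.1] at hv1
  exact zero_ne_one hv1
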